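/- For a plain subtree, the named-subtree semantics is hierarchy concatenation: for every f ∈ 𝔸 and every plain process tree P (a process tree containing no named-subtree nodes ▽ and no recursion leaves △), L(▽_f(P)) = f.L(P) = { f.t | t ∈ L(P) }. -/

import Mathlib

/-- Symbols: activities `a ∈ 𝔸` and recursion markers `△_f`. -/
inductive HSym (A : Type*) where
  | act : A → HSym A
  | mark : A → HSym A

/-- An event is a finite sequence of symbols. -/
abbrev Event (A : Type*) := List (HSym A)

/-- A hierarchical trace is a finite sequence of events. -/
abbrev HTrace (A : Type*) := List (Event A)

/-- Hierarchy concatenation `s.t`: prefix the symbol `s` to every event of the trace `t`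
(for the empty trace it yields the single event `⟨s⟩`). -/
def hcat {A : Type*} (s : HSym A) : HTrace A → HTrace A
  | [] => [[s]]
  | t => t.map (s :: ·)

/-- Interleaving (shuffle) of two sequences. -/
inductive Interleaving {α : Type*} : List α → List α → List α → Prop
  | nil : Interleaving [] [] []
  | left {a t₁ t₂ t} : Interleaving t₁ t₂ t → Interleaving (a :: t₁) t₂ (a :: t)
  | right {a t₁ t₂ t} : Interleaving t₁ t₂ t → Interleaving t₁ (a :: t₂) (a :: t)

/-- Sequence join. -/
def seqJoin {α : Type*} : List (Set (List α)) → Set (List α)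
  | [] => {[]}
  | L :: Ls => {t | ∃ t₁ ∈ L, ∃ t₂ ∈ seqJoin Ls, t = t₁ ++ t₂}

/-- Exclusive-choice join. -/
def choiceJoin {α : Type*} (Ls : List (Set (List α))) : Set (List α) :=
  {t | ∃ L ∈ Ls, t ∈ L}

/-- Members of the loop language. -/
inductive LoopMem {α : Type*} (body redo : Set (List α)) : List α → Prop
  | single {t} : t ∈ body → LoopMem body redo t
  | cons {t t' r} : t ∈ body → t' ∈ redo → LoopMem body redo r →
      LoopMem body redo (t ++ t' ++ r)

/-- Structured-loop join. -/
def loopJoin {α : Type*} : List (Set (List α)) → Set (List α)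
  | [] => ∅
  | L :: Ls => {t | LoopMem L (choiceJoin Ls) t}

/-- Parallel join. -/
def parJoin {α : Type*} : List (Set (List α)) → Set (List α)
  | [] => {[]}
  | L :: Ls => {t | ∃ t₁ ∈ L, ∃ t₂ ∈ parJoin Ls, Interleaving t₁ t₂ t}

/-- Hierarchical process trees: process trees extended with the named-subtree
operator `▽_f` and the recursion leaf `△_f`. -/
inductive HTree (A : Type*) where
  | act : A → HTree A
  | tau : HTree A
  | seq : List (HTree A) → HTree A
  | choice : List (HTree A) → HTree A
  | loop : List (HTree A) → HTree A
  | par : List (HTree A) → HTree A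
  | named : A → HTree A → HTree A
  | recCall : A → HTree A

universe u

mutual
/-- `▽ˡ_f(M)`: the least hierarchical language satisfying
`▽ˡ_f(M) = { f.(t′₁ ⋯ t′ₙ) | ⟨x₁,…,xₙ⟩ ∈ M, t′ᵢ ∈ ψ_f(xᵢ) }`. -/
inductive NamedLang {A : Type u} (f : A) (M : Set (HTrace A)) : HTrace A → Prop
  | mk (xs : HTrace A) (ts : List (HTrace A)) :
      xs ∈ M → ts.length = xs.length →
      (∀ i, Psi f M (xs.getD i []) (ts.getD i [])) →
      NamedLang f M (hcat (HSym.act f) ts.flatten)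

/-- `ψ_f`: maps an event to the set of traces resolving the recursion markers `△_f`. -/
inductive Psi {A : Type u} (f : A) (M : Set (HTrace A)) : Event A → HTrace A → Prop
  | nil : Psi f M [] []
  | recSame {t : HTrace A} : NamedLang f M t → Psi f M [HSym.mark f] t
  | recOther {g : A} : g ≠ f → Psi f M [HSym.mark g] [[HSym.mark g]]
  | act {a : A} {x : Event A} {t : HTrace A} :
      Psi f M x t → Psi f M (HSym.act a :: x) (hcat (HSym.act a) t)
end

/-- The hierarchical language of a hierarchical process tree. -/
def hlang {A : Type*} : HTree A → Set (HTrace A)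
  | .act a => {[[HSym.act a]]}
  | .tau => {[]}
  | .recCall f => {[[HSym.mark f]]}
  | .seq Ps => seqJoin (Ps.attach.map fun p => hlang p.1)
  | .choice Ps => choiceJoin (Ps.attach.map fun p => hlang p.1)
  | .loop Ps => loopJoin (Ps.attach.map fun p => hlang p.1)
  | .par Ps => parJoin (Ps.attach.map fun p => hlang p.1)
  | .named f P => {t | NamedLang f (hlang P) t}
termination_by P => sizeOf P
decreasing_by
  all_goals first
    | (have := List.sizeOf_lt_of_mem p.2; simp; omega)
    | simp

/-- Plain process trees: no named subtrees `▽` and no recursion leaves `△`. -/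
inductive IsPlain {A : Type*} : HTree A → Prop
  | act (a : A) : IsPlain (HTree.act a)
  | tau : IsPlain HTree.tau
  | seq {Ps : List (HTree A)} : (∀ P ∈ Ps, IsPlain P) → IsPlain (HTree.seq Ps)
  | choice {Ps : List (HTree A)} : (∀ P ∈ Ps, IsPlain P) → IsPlain (HTree.choice Ps)
  | loop {Ps : List (HTree A)} : (∀ P ∈ Ps, IsPlain P) → IsPlain (HTree.loop Ps)
  | par {Ps : List (HTree A)} : (∀ P ∈ Ps, IsPlain P) → IsPlain (HTree.par Ps)


section Joins

variable {α : Type*} {p : α → Prop}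

theorem Interleaving.forall_mem {t₁ t₂ t : List α} (h : Interleaving t₁ t₂ t)
    (h₁ : ∀ x ∈ t₁, p x) (h₂ : ∀ x ∈ t₂, p x) : ∀ x ∈ t, p x := by
  induction h with
  | nil => exact h₁
  | left _ ih =>
    rw [List.forall_mem_cons] at h₁ ⊢
    exact ⟨h₁.1, ih h₁.2 h₂⟩
  | right _ ih =>
    rw [List.forall_mem_cons] at h₂ ⊢
    exact ⟨h₂.1, ih h₁ h₂.2⟩

theorem forall_mem_of_mem_seqJoin {Ls : List (Set (List α))}
    (hLs : ∀ L ∈ Ls, ∀ t ∈ L, ∀ x ∈ t, p x) : ∀ t ∈ seqJoin Ls, ∀ x ∈ t, p x := by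
  induction Ls with
  | nil => rintro t rfl; simp
  | cons L Ls ih =>
    rw [List.forall_mem_cons] at hLs
    rintro _ ⟨t₁, h₁, t₂, h₂, rfl⟩
    exact List.forall_mem_append.2 ⟨hLs.1 t₁ h₁, ih hLs.2 t₂ h₂⟩

theorem forall_mem_of_mem_choiceJoin {Ls : List (Set (List α))}
    (hLs : ∀ L ∈ Ls, ∀ t ∈ L, ∀ x ∈ t, p x) : ∀ t ∈ choiceJoin Ls, ∀ x ∈ t, p x := by
  rintro t ⟨L, hL, ht⟩
  exact hLs L hL t ht

theorem LoopMem.forall_mem {body redo : Set (List α)} (hbody : ∀ t ∈ body, ∀ x ∈ t, p x)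
    (hredo : ∀ t ∈ redo, ∀ x ∈ t, p x) {t : List α} (h : LoopMem body redo t) :
    ∀ x ∈ t, p x := by
  induction h with
  | single ht => exact hbody _ ht
  | cons ht ht' _ ih =>
    exact List.forall_mem_append.2 ⟨List.forall_mem_append.2 ⟨hbody _ ht, hredo _ ht'⟩, ih⟩

theorem forall_mem_of_mem_loopJoin {Ls : List (Set (List α))}
    (hLs : ∀ L ∈ Ls, ∀ t ∈ L, ∀ x ∈ t, p x) : ∀ t ∈ loopJoin Ls, ∀ x ∈ t, p x := by
  cases Ls with
  | nil => rintro t ⟨⟩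
  | cons L Ls =>
    rw [List.forall_mem_cons] at hLs
    exact fun t ht => LoopMem.forall_mem hLs.1 (forall_mem_of_mem_choiceJoin hLs.2) ht

theorem forall_mem_of_mem_parJoin {Ls : List (Set (List α))}
    (hLs : ∀ L ∈ Ls, ∀ t ∈ L, ∀ x ∈ t, p x) : ∀ t ∈ parJoin Ls, ∀ x ∈ t, p x := by
  induction Ls with
  | nil => rintro t rfl; simp
  | cons L Ls ih =>
    rw [List.forall_mem_cons] at hLs
    rintro t ⟨t₁, h₁, t₂, h₂, h⟩
    exact h.forall_mem (hLs.1 t₁ h₁) (ih hLs.2 t₂ h₂)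

end Joins

/-- The traces of a plain process tree consist of events made of a single activity. -/
theorem IsPlain.exists_eq_act {A : Type*} {P : HTree A} (hP : IsPlain P) :
    ∀ t ∈ hlang P, ∀ e ∈ t, ∃ a, e = [HSym.act a] := by
  have children {Ps : List (HTree A)}
      (ih : ∀ P ∈ Ps, ∀ t ∈ hlang P, ∀ e ∈ t, ∃ a, e = [HSym.act a]) :
      ∀ L ∈ Ps.attach.map (fun p => hlang p.1), ∀ t ∈ L, ∀ e ∈ t, ∃ a, e = [HSym.act a] := by
    intro L hL
    obtain ⟨p, -, rfl⟩ := List.mem_map.1 hL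
    exact ih p.1 p.2
  induction hP with
  | act a => simp [hlang]
  | tau => simp [hlang]
  | seq _ ih => rw [hlang]; exact forall_mem_of_mem_seqJoin (children ih)
  | choice _ ih => rw [hlang]; exact forall_mem_of_mem_choiceJoin (children ih)
  | loop _ ih => rw [hlang]; exact forall_mem_of_mem_loopJoin (children ih)
  | par _ ih => rw [hlang]; exact forall_mem_of_mem_parJoin (children ih)

theorem psi_nil_iff {A : Type*} {f : A} {M : Set (HTrace A)} {t : HTrace A} :
    Psi f M [] t ↔ t = [] :=
  ⟨fun h => by cases h; rfl, fun h => h ▸ Psi.nil⟩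

theorem psi_act_iff {A : Type*} {f a : A} {M : Set (HTrace A)} {t : HTrace A} :
    Psi f M [HSym.act a] t ↔ t = [[HSym.act a]] := by
  constructor
  · intro h
    cases h with
    | act h => rw [psi_nil_iff.1 h]; rfl
  · rintro rfl
    exact Psi.act Psi.nil

/-- Resolving the events of a trace of single activities changes nothing. -/
theorem forall_psi_iff {A : Type*} {f : A} {M : Set (HTrace A)} {xs : HTrace A}
    (hxs : ∀ e ∈ xs, ∃ a, e = [HSym.act a]) {ts : List (HTrace A)}
    (hlen : ts.length = xs.length) :
    (∀ i, Psi f M (xs.getD i []) (ts.getD i [])) ↔ ts = xs.map fun e => [e] := by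
  induction xs generalizing ts with
  | nil =>
    obtain rfl := List.length_eq_zero_iff.1 hlen
    simp [psi_nil_iff]
  | cons x xs ih =>
    obtain _ | ⟨t, ts⟩ := ts
    · simp at hlen
    rw [List.forall_mem_cons] at hxs
    obtain ⟨⟨a, rfl⟩, hxs⟩ := hxs
    rw [List.map_cons, List.cons.injEq, ← ih hxs (by simpa using hlen), ← psi_act_iff (f := f)
      (M := M)]
    exact Nat.and_forall_add_one.symm

/-- for a plain subtree, the named-subtree semantics is hierarchy
concatenation: `L(▽_f(P)) = f.L(P)`. -/
theorem named_plain_lang {A : Type*} (f : A) (P : HTree A) (hP : IsPlain P) :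
    hlang (HTree.named f P) = hcat (HSym.act f) '' hlang P := by
  have flatten_singletons (xs : HTrace A) : (xs.map fun e => [e]).flatten = xs := by
    induction xs with
    | nil => rfl
    | cons x xs ih => simpa using ih
  rw [hlang]
  ext t
  constructor
  · rintro ⟨xs, ts, hxs, hlen, h⟩
    rw [(forall_psi_iff (hP.exists_eq_act xs hxs) hlen).1 h, flatten_singletons]
    exact Set.mem_image_of_mem _ hxs
  · rintro ⟨xs, hxs, rfl⟩
    have h := NamedLang.mk (f := f) (M := hlang P) xs (xs.map fun e => [e]) hxs (by simp)
      ((forall_psi_iff (hP.exists_eq_act xs hxs) (by simp)).2 rfl)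
    rwa [flatten_singletons] at h
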